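/- arXiv:2102.01665 — 5 statements merged into one kernel-verified Lean document; each statement's English description precedes it below -/
import Mathlib

section
/- Let F be a field, and let K, D, L be positive integers with 1 ≤ L ≤ D ≤ K. Set T = K - D + 1. For each i ∈ {1, ..., T}, let V_i be an L × D matrix over F every L × L submatrix of which is invertible, and let U_i be the L × K matrix whose column (i + j - 1) equals the j-th column of V_i for j = 1, ..., D and whose remaining columns are zero (so the rows of U_i are supported on the window W_i = {i, i+1, ..., i+D-1}). Then the span in F^K of all the rows of U_1, ..., U_T has dimension at least K - D + L. -/
/-- A matrix all of whose maximal square submatrices are invertible has no zero column. -/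
theorem exists_ne_zero_of_isUnit_submatrix {F : Type*} [Field F] {L D : ℕ} (hL : 1 ≤ L)
    (hLD : L ≤ D) (V : Matrix (Fin L) (Fin D) F)
    (hV : ∀ g : Fin L → Fin D, Function.Injective g → IsUnit (V.submatrix id g)) (j : Fin D) :
    ∃ l, V l j ≠ 0 := by
  by_contra! h
  let e : Fin D ≃ Fin D := Equiv.swap ⟨0, by omega⟩ j
  have hu := hV (fun k => e (Fin.castLE hLD k)) (e.injective.comp (Fin.castLE_injective hLD))
  rw [Matrix.isUnit_iff_isUnit_det] at hu
  refine hu.ne_zero (Matrix.det_eq_zero_of_column_eq_zero ⟨0, by omega⟩ fun l => ?_)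
  have he : e (Fin.castLE hLD ⟨0, by omega⟩) = j := Equiv.swap_apply_left _ _
  simpa only [Matrix.submatrix_apply, id_eq, he] using h l


/-- Let F be a field and 1 ≤ L ≤ D ≤ K, T = K - D + 1. For each i, V i is an
L × D MDS matrix (every L × L submatrix invertible), and U i is the L × K matrix whose
columns in the window {i, ..., i + D - 1} are the columns of V i (in order) and whose
remaining columns are zero. Then the span of all rows of U 1, ..., U T has dimension at
least K - D + L. -/
theorem stmt_0 {F : Type*} [Field F]
    (K D L : ℕ) (hL : 1 ≤ L) (hLD : L ≤ D) (hDK : D ≤ K)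
    (V : Fin (K - D + 1) → Matrix (Fin L) (Fin D) F)
    (hV : ∀ (i : Fin (K - D + 1)) (g : Fin L → Fin D),
      Function.Injective g → IsUnit ((V i).submatrix id g))
    (U : Fin (K - D + 1) → Matrix (Fin L) (Fin K) F)
    (hU : ∀ (i : Fin (K - D + 1)) (l : Fin L) (k : Fin K),
      U i l k =
        if h : (i : ℕ) ≤ (k : ℕ) ∧ (k : ℕ) < (i : ℕ) + D then
          V i l ⟨(k : ℕ) - (i : ℕ), by omega⟩
        else 0) :
    K - D + L ≤ Module.finrank F
      ↥(Submodule.span F (Set.range fun q : Fin (K - D + 1) × Fin L => U q.1 q.2)) := by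
  let S : ℕ → Submodule F (Fin K → F) := fun m =>
    Submodule.span F {x | ∃ (i : Fin (K - D + 1)) (l : Fin L), (i : ℕ) ≤ m ∧ U i l = x}
  have hS : ∀ m, m ≤ K - D → m + L ≤ Module.finrank F (S m) := by
    intro m
    induction m with
    | zero =>
      intro _
      have hli : LinearIndependent F (fun l => U 0 l) := by
        apply LinearIndependent.of_comp (LinearMap.funLeft F F (Fin.castLE (hLD.trans hDK)))
        have hrows := Matrix.linearIndependent_rows_of_isUnit
          (hV 0 (Fin.castLE hLD) (Fin.castLE_injective hLD))
        convert hrows using 1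
        ext l k
        have hk : (k : ℕ) < D := k.2.trans_le hLD
        simp [LinearMap.funLeft_apply, hU, hk, Matrix.row, Fin.castLE]
      have hcard := finrank_span_eq_card hli
      rw [Fintype.card_fin] at hcard
      rw [zero_add, ← hcard]
      apply Submodule.finrank_mono
      apply Submodule.span_mono
      rintro _ ⟨l, rfl⟩
      exact ⟨0, l, le_rfl, rfl⟩
    | succ m ih =>
      intro hm
      obtain ⟨l, hl⟩ := exists_ne_zero_of_isUnit_submatrix hL hLD
        (V ⟨m + 1, by omega⟩) (hV _) ⟨D - 1, by omega⟩
      have hlt : S m < S (m + 1) := by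
        refine SetLike.lt_iff_le_and_exists.mpr
          ⟨Submodule.span_mono ?_, U ⟨m + 1, by omega⟩ l, ?_, fun hmem => ?_⟩
        · rintro _ ⟨i, l, hi, rfl⟩
          exact ⟨i, l, by omega, rfl⟩
        · exact Submodule.subset_span ⟨_, l, le_rfl, rfl⟩
        · have hker : S m ≤ LinearMap.ker
              (LinearMap.proj (R := F) (φ := fun _ : Fin K => F) ⟨m + D, by omega⟩) := by
            rw [Submodule.span_le]
            rintro _ ⟨i, l, hi, rfl⟩
            simp only [SetLike.mem_coe, LinearMap.mem_ker, LinearMap.proj_apply, hU]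
            exact dif_neg (by omega)
          have hzero := hker hmem
          rw [LinearMap.mem_ker, LinearMap.proj_apply, hU,
            dif_pos (by simp only; omega)] at hzero
          apply hl
          convert hzero using 3
          simp only
          omega
      have := Submodule.finrank_lt_finrank_of_lt hlt
      have := ih (by omega)
      omega
  refine (hS (K - D) le_rfl).trans (Submodule.finrank_mono (Submodule.span_mono ?_))
  rintro _ ⟨i, l, -, rfl⟩
  exact ⟨(i, l), rfl⟩
end

section
/- Let F be a finite field with q elements, and let K, D, L be positive integers with 1 ≤ L ≤ D ≤ K; set T = K - D + 1. Let X : Ω → F^K be uniformly distributed on F^K. For each i ∈ {1, ..., T}, let V_i be an L × D matrix over F every L × L submatrix of which is invertible, and define the random vector Z_i = V_i · X_{W_i}, where X_{W_i} = (X_i, X_{i+1}, ..., X_{i+D-1})ᵀ is the restriction of X to the window W_i = {i, ..., i+D-1}. Then the joint Shannon entropy satisfies H(Z_1, ..., Z_T) ≥ (K - D + L) · log q. -/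
/-- The probability that a random variable `Y` on a finite probability space with mass
function `p` takes the value `s`. -/
noncomputable def prob {Ω S : Type*} [Fintype Ω] [DecidableEq S]
    (p : Ω → ℝ) (Y : Ω → S) (s : S) : ℝ :=
  ∑ ω ∈ Finset.univ.filter (fun ω => Y ω = s), p ω

/-- The Shannon entropy `H(Y) = -∑_s P(Y = s) log P(Y = s)` of a random variable `Y`
with finite range. -/
noncomputable def entropy {Ω S : Type*} [Fintype Ω] [Fintype S] [DecidableEq S]
    (p : Ω → ℝ) (Y : Ω → S) : ℝ :=
  ∑ s : S, -(prob p Y s * Real.log (prob p Y s))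

section Entropy

variable {Ω S : Type*} [Fintype Ω] [DecidableEq S] {p : Ω → ℝ}

lemma prob_nonneg (hp : ∀ ω, 0 ≤ p ω) (Y : Ω → S) (s : S) : 0 ≤ prob p Y s :=
  Finset.sum_nonneg fun ω _ => hp ω

lemma sum_prob [Fintype S] (p : Ω → ℝ) (Y : Ω → S) : ∑ s, prob p Y s = ∑ ω, p ω :=
  Finset.sum_fiberwise _ _ _

lemma prob_comp {R : Type*} [Fintype R] [DecidableEq R] (p : Ω → ℝ) (X : Ω → R) (f : R → S)
    (s : S) :
    prob p (fun ω => f (X ω)) s = ∑ x with f x = s, prob p X x := by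
  simp only [prob, Finset.sum_filter]
  rw [← Finset.sum_fiberwise Finset.univ X]
  refine Finset.sum_congr rfl fun x _ => ?_
  rw [Finset.sum_filter]
  split_ifs with h
  · refine Finset.sum_congr rfl fun ω _ => ?_
    by_cases hx : X ω = x <;> simp [hx, h]
  · refine Finset.sum_eq_zero fun ω _ => ?_
    by_cases hx : X ω = x <;> simp [hx, h]

/-- Shannon entropy is at least min-entropy. -/
lemma le_entropy_of_prob_le [Fintype S] (hp : ∀ ω, 0 ≤ p ω) (hp1 : ∑ ω, p ω = 1) (Y : Ω → S)
    {c : ℝ} (hc : ∀ s, prob p Y s ≤ Real.exp (-c)) : c ≤ entropy p Y := by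
  calc c = ∑ s, prob p Y s * c := by rw [← Finset.sum_mul, sum_prob, hp1, one_mul]
    _ ≤ entropy p Y := by
      refine Finset.sum_le_sum fun s _ => ?_
      rcases (prob_nonneg hp Y s).eq_or_lt with h | h
      · simp [← h]
      · have := (Real.log_le_iff_le_exp h).2 (hc s)
        nlinarith

end Entropy

section Windows

variable {F : Type*} [Field F]

lemma eq_zero_of_mulVec_eq_zero_of_isUnit_submatrix {m n : Type*} [Fintype m] [DecidableEq m]
    [Fintype n] {A : Matrix m n F} {g : m → n} (hg : Function.Injective g)
    (hA : IsUnit (A.submatrix id g)) {v : n → F} (hv : ∀ j ∉ Set.range g, v j = 0)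
    (h : A.mulVec v = 0) : v = 0 := by
  have key : (A.submatrix id g).mulVec (v ∘ g) = 0 := by
    rw [← h]
    funext k
    exact Finset.sum_of_injOn g hg.injOn (by simp)
      (fun j _ hj => by rw [hv j (by simpa using hj), mul_zero]) (fun _ _ => rfl)
  have hz : v ∘ g = 0 := Matrix.mulVec_injective_of_isUnit hA (by simpa using key)
  funext j
  by_cases hj : j ∈ Set.range g
  · obtain ⟨k, rfl⟩ := hj
    exact congrFun hz k
  · exact hv j hj

/-- A vector annihilated by an MDS matrix on every window of length `D` vanishes as soon as its
first `D - L` coordinates do. -/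
lemma eq_zero_of_windows_mulVec_eq_zero {K D L : ℕ} (hL : 1 ≤ L) (hLD : L ≤ D) (hDK : D ≤ K)
    {V : Fin (K - D + 1) → Matrix (Fin L) (Fin D) F}
    (hV : ∀ (i : Fin (K - D + 1)) (g : Fin L → Fin D),
      Function.Injective g → IsUnit ((V i).submatrix id g))
    {w : Fin (K - D + 1) → Fin D → Fin K} (hw : ∀ i j, (w i j : ℕ) = i + j)
    {x : Fin K → F} (hx : ∀ j : Fin K, (j : ℕ) < D - L → x j = 0)
    (h : ∀ i, (V i).mulVec (fun j => x (w i j)) = 0) : x = 0 := by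
  suffices ∀ n (hn : n < K), x ⟨n, hn⟩ = 0 from funext fun j => this j j.isLt
  intro n
  induction n using Nat.strong_induction_on with
  | _ n ih =>
    intro hn
    by_cases hnD : n < D - L
    · exact hx _ hnD
    let i : Fin (K - D + 1) := ⟨n - (D - 1), by omega⟩
    let g : Fin L → Fin D := fun k => ⟨D - L + k, by omega⟩
    have hg : Function.Injective g := fun a b hab => by
      simp only [g, Fin.mk.injEq] at hab
      exact Fin.ext (by omega)
    have hzero := eq_zero_of_mulVec_eq_zero_of_isUnit_submatrix hg (hV i g hg) (fun j hj => by
      have hj' : (j : ℕ) < D - L := by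
        by_contra hc
        exact hj ⟨⟨j - (D - L), by omega⟩, Fin.ext (by simp only [g]; omega)⟩
      exact ih (w i j) (by rw [hw]; simp only [i]; omega) _) (h i)
    have hn' : w i ⟨n - (n - (D - 1)), by omega⟩ = ⟨n, hn⟩ :=
      Fin.ext (by rw [hw]; simp only [i]; omega)
    rw [← hn']
    exact congrFun hzero _

end Windows

/-- let `1 ≤ L ≤ D ≤ K`, `T = K - D + 1`, `X` uniform on `F^K`, and for
each `i` let `V i` be an `L × D` MDS matrix (every `L × L` submatrix invertible) and
`Z i = (V i) · X_{W_i}` where `W_i = {i, ..., i + D - 1}`. Then the joint entropy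
`H(Z_1, ..., Z_T) ≥ (K - D + L) · log q`. -/
theorem stmt_3 {F : Type*} [Field F] [Fintype F] [DecidableEq F]
    {Ω : Type*} [Fintype Ω]
    (p : Ω → ℝ) (hp : ∀ ω, 0 ≤ p ω) (hp1 : ∑ ω, p ω = 1)
    (K D L : ℕ) (hL : 1 ≤ L) (hLD : L ≤ D) (hDK : D ≤ K)
    (X : Ω → (Fin K → F))
    (hX : ∀ x : Fin K → F, prob p X x = 1 / (Fintype.card F : ℝ) ^ K)
    (V : Fin (K - D + 1) → Matrix (Fin L) (Fin D) F)
    (hV : ∀ (i : Fin (K - D + 1)) (g : Fin L → Fin D),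
      Function.Injective g → IsUnit ((V i).submatrix id g)) :
    ((K - D + L : ℕ) : ℝ) * Real.log (Fintype.card F) ≤
      entropy p (fun ω => fun i : Fin (K - D + 1) =>
        (V i).mulVec (fun j : Fin D =>
          X ω ⟨(i : ℕ) + (j : ℕ), by have := i.isLt; have := j.isLt; omega⟩)) := by
  have hq : (0 : ℝ) < Fintype.card F := by exact_mod_cast Fintype.card_pos
  let w : Fin (K - D + 1) → Fin D → Fin K := fun i j => ⟨i + j, by omega⟩
  let M : (Fin K → F) → Fin (K - D + 1) → Fin L → F := fun x i =>
    (V i).mulVec (fun j => x (w i j))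
  refine le_entropy_of_prob_le hp hp1 (fun ω => M (X ω)) fun z => ?_
  let r : (Fin K → F) → Fin (D - L) → F := fun x j => x ⟨j, by omega⟩
  have hcard : (Finset.univ.filter fun x => M x = z).card ≤ Fintype.card F ^ (D - L) := by
    refine (Finset.card_le_card_of_injOn r (t := Finset.univ) (by simp) ?_).trans (by simp)
    intro x hx y hy hxy
    simp only [Finset.coe_filter, Finset.mem_univ, true_and, Set.mem_ofPred_eq] at hx hy
    refine sub_eq_zero.1 (eq_zero_of_windows_mulVec_eq_zero hL hLD hDK hV (w := w) (fun _ _ => rfl)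
      (fun j hj => ?_) fun i => ?_)
    · exact sub_eq_zero.2 (congrFun hxy ⟨j, hj⟩)
    · exact (Matrix.mulVec_sub (V i) _ _).trans
        (sub_eq_zero.2 (congrFun (hx.trans hy.symm) i))
  have hpow : (Fintype.card F : ℝ) ^ K
      = (Fintype.card F : ℝ) ^ (D - L) * (Fintype.card F : ℝ) ^ (K - D + L) := by
    rw [← pow_add]
    congr 1
    omega
  rw [prob_comp p X M z, Finset.sum_congr rfl fun x _ => hX x, Finset.sum_const, nsmul_eq_mul,
    Real.exp_neg, Real.exp_nat_mul, Real.exp_log hq, mul_one_div, ← one_div,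
    div_le_div_iff₀ (by positivity) (by positivity), one_mul, hpow]
  gcongr
  exact_mod_cast hcard
end

section
/- Let F be a field, let 1 ≤ L < D ≤ K, let ω_1, ..., ω_K be pairwise distinct elements of F and λ_1, ..., λ_K nonzero elements of F. Define the (D-L) × K matrix H by H_{i,j} = λ_j ω_j^{i-1}, set α_j = λ_j^{-1} · ∏_{k ∈ {1,...,K}\{j}} (ω_j - ω_k)^{-1}, and define the (K-D+L) × K matrix G by G_{i,j} = α_j ω_j^{i-1}. Then G · Hᵀ = 0, and the row space of G equals the null space {x ∈ F^K : H·x = 0} of H. -/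
/-- The rows of a generator matrix `λ_j ω_j ^ i` of a generalized Reed–Solomon code are linearly
independent. -/
theorem linearIndependent_rows_mul_pow {F : Type*} [Field F] {m K : ℕ} (hmK : m ≤ K)
    {ω c : Fin K → F} (hω : Function.Injective ω) (hc : ∀ j, c j ≠ 0)
    {M : Matrix (Fin m) (Fin K) F} (hM : ∀ i j, M i j = c j * ω j ^ (i : ℕ)) :
    LinearIndependent F M.row := by
  have hdet : ((Matrix.vandermonde ω).transpose * Matrix.diagonal c).det ≠ 0 := by
    rw [Matrix.det_mul, Matrix.det_transpose, Matrix.det_diagonal]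
    exact mul_ne_zero (Matrix.det_vandermonde_ne_zero_iff.2 hω)
      (Finset.prod_ne_zero_iff.2 fun j _ => hc j)
  have h := (Matrix.linearIndependent_rows_of_det_ne_zero hdet).comp (Fin.castLE hmK)
    (Fin.castLE_injective hmK)
  have hrow : M.row =
      (fun i => ((Matrix.vandermonde ω).transpose * Matrix.diagonal c) i) ∘ Fin.castLE hmK := by
    ext i j
    simp [hM, Matrix.mul_diagonal, Matrix.vandermonde_apply, mul_comm]
  rw [hrow]
  exact h

/-- The divided difference of `X ^ n` at more than `n + 1` nodes vanishes. -/
theorem sum_pow_mul_prod_inv_sub_eq_zero {F : Type*} [Field F] {K n : ℕ} (hn : n + 1 < K)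
    {ω : Fin K → F} (hω : Function.Injective ω) :
    ∑ j, ω j ^ n * ∏ k ∈ Finset.univ.erase j, (ω j - ω k)⁻¹ = 0 := by
  have h := Lagrange.coeff_eq_sum (s := Finset.univ) (P := (Polynomial.X ^ n : Polynomial F))
    hω.injOn (by rw [Polynomial.degree_X_pow, Finset.card_fin]; norm_cast; lia)
  rw [Polynomial.coeff_X_pow, Finset.card_fin, if_neg (by lia)] at h
  simpa [div_eq_mul_inv] using h.symm


/-- let `1 ≤ L < D ≤ K`, `ω_j` pairwise distinct, `λ_j` nonzero,
`H_{i,j} = λ_j ω_j^{i-1}`, `α_j = λ_j⁻¹ ∏_{k ≠ j} (ω_j - ω_k)⁻¹`, and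
`G_{i,j} = α_j ω_j^{i-1}`. Then `G · Hᵀ = 0` and the row space of `G` equals the null
space `{x : H·x = 0}` of `H`. -/
theorem stmt_9 {F : Type*} [Field F] (L D K : ℕ) (hL : 1 ≤ L) (hLD : L < D) (hDK : D ≤ K)
    (ω : Fin K → F) (hω : Function.Injective ω)
    (lam : Fin K → F) (hlam : ∀ j, lam j ≠ 0)
    (H : Matrix (Fin (D - L)) (Fin K) F)
    (hH : ∀ (i : Fin (D - L)) (j : Fin K), H i j = lam j * ω j ^ (i : ℕ))
    (alph : Fin K → F)
    (halph : ∀ j, alph j = (lam j)⁻¹ * ∏ k ∈ Finset.univ.erase j, (ω j - ω k)⁻¹)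
    (G : Matrix (Fin (K - D + L)) (Fin K) F)
    (hG : ∀ (i : Fin (K - D + L)) (j : Fin K), G i j = alph j * ω j ^ (i : ℕ)) :
    G * H.transpose = 0 ∧
      Submodule.span F (Set.range fun i => G i) = LinearMap.ker H.mulVecLin := by
  have hmul : G * H.transpose = 0 := by
    ext a b
    rw [Matrix.mul_apply, Matrix.zero_apply,
      ← sum_pow_mul_prod_inv_sub_eq_zero (n := a + b) (by lia) hω]
    refine Finset.sum_congr rfl fun j _ => ?_
    rw [Matrix.transpose_apply, hG, hH, halph, pow_add]
    field_simp [hlam j]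
  refine ⟨hmul, Submodule.eq_of_le_of_finrank_eq ?_ ?_⟩
  · rw [Submodule.span_le]
    rintro _ ⟨a, rfl⟩
    rw [SetLike.mem_coe, LinearMap.mem_ker, Matrix.mulVecLin_apply]
    ext b
    rw [Pi.zero_apply, ← Matrix.zero_apply (α := F) a b, ← hmul, Matrix.mul_apply']
    exact dotProduct_comm _ _
  · have halph_ne : ∀ j, alph j ≠ 0 := fun j => by
      rw [halph]
      refine mul_ne_zero (inv_ne_zero (hlam j)) (Finset.prod_ne_zero_iff.2 fun k hk => ?_)
      exact inv_ne_zero (sub_ne_zero.2 (hω.ne (Finset.ne_of_mem_erase hk).symm))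
    have hGrank : Module.finrank F (Submodule.span F (Set.range fun i => G i)) = K - D + L :=
      (finrank_span_eq_card (linearIndependent_rows_mul_pow (by lia) hω halph_ne hG)).trans
        (Fintype.card_fin _)
    have hHrank : Module.finrank F (LinearMap.range H.mulVecLin) = D - L :=
      (linearIndependent_rows_mul_pow (by lia) hω hlam hH).rank_matrix.trans (Fintype.card_fin _)
    have hnullity := LinearMap.finrank_range_add_finrank_ker H.mulVecLin
    rw [hHrank, Module.finrank_fin_fun] at hnullity
    lia
end

section
/- Let F be a field, 1 ≤ L ≤ D ≤ K with L < D, let ω_1, ..., ω_K be pairwise distinct elements of F and ν_1, ..., ν_D nonzero elements of F. For j ≤ D set α_j = ν_j · ∏_{k=D+1}^{K} (ω_j - ω_k)^{-1}, and for D < j ≤ K let α_j be arbitrary. For l ∈ {1, ..., L}, define the polynomial f_l(x) = x^{l-1} · ∏_{j=D+1}^{K} (x - ω_j) ∈ F[x], and let c_l = (c_{l,1}, ..., c_{l,K-D+L})ᵀ, where c_{l,i} is the coefficient of x^{i-1} in f_l. Let G be the (K-D+L) × K matrix with G_{i,j} = α_j ω_j^{i-1}. Then: (i) α_j · f_l(ω_j)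 = ν_j ω_j^{l-1} for every j ∈ {1, ..., D}; (ii) f_l(ω_j) = 0 for every j ∈ {D+1, ..., K}; consequently (iii) the row vector c_lᵀ · G has j-th entry ν_j ω_j^{l-1} for j ≤ D and 0 for j > D. -/
theorem card_filter_le_val (K D : ℕ) :
    (Finset.univ.filter (fun k : Fin K => D ≤ (k : ℕ))).card = K - D := by
  rw [← Finset.card_map Fin.valEmbedding, ← Nat.card_Ico D K]
  congr 1
  ext k
  simp only [Finset.mem_map, Finset.mem_filter, Finset.mem_univ, true_and, Finset.mem_Ico,
    Fin.valEmbedding_apply]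
  exact ⟨by rintro ⟨i, hi, rfl⟩; exact ⟨hi, i.isLt⟩, fun ⟨h, h'⟩ => ⟨⟨k, h'⟩, h, rfl⟩⟩

theorem natDegree_X_pow_mul_prod_X_sub_C {R ι : Type*} [CommRing R] [Nontrivial R]
    (n : ℕ) (s : Finset ι) (a : ι → R) :
    (Polynomial.X ^ n * ∏ i ∈ s, (Polynomial.X - Polynomial.C (a i))).natDegree
      = s.card + n := by
  rw [(Polynomial.monic_X_pow n).natDegree_mul (Polynomial.monic_prod_X_sub_C a s),
    Polynomial.natDegree_X_pow, Polynomial.natDegree_finsetProd_X_sub_C_eq_card, add_comm]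

/-- let `1 ≤ L ≤ D ≤ K` with `L < D`, `ω_1, ..., ω_K` pairwise distinct,
`ν_1, ..., ν_D` nonzero, `α_j = ν_j ∏_{k=D+1}^{K} (ω_j - ω_k)⁻¹` for `j ≤ D` (and
arbitrary for `j > D`). For `l ∈ {1, ..., L}` let `f_l(x) = x^{l-1} ∏_{j=D+1}^{K} (x - ω_j)`,
let `c_{l,i}` be the coefficient of `x^{i-1}` in `f_l` for `i ∈ {1, ..., K-D+L}`, and
let `G_{i,j} = α_j ω_j^{i-1}`. Then:
(i) `α_j f_l(ω_j) = ν_j ω_j^{l-1}` for `j ∈ {1, ..., D}`;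
(ii) `f_l(ω_j) = 0` for `j ∈ {D+1, ..., K}`;
(iii) the `j`-th entry of the row vector `c_lᵀ · G` is `ν_j ω_j^{l-1}` for `j ≤ D` and
`0` for `j > D`. -/
theorem stmt_11 {F : Type*} [Field F] (L D K : ℕ)
    (hL : 1 ≤ L) (hLD : L ≤ D) (hLD' : L < D) (hDK : D ≤ K)
    (ω : Fin K → F) (hω : Function.Injective ω)
    (ν : Fin D → F) (hν : ∀ j, ν j ≠ 0)
    (alph : Fin K → F)
    (halph : ∀ j : Fin D, alph (Fin.castLE hDK j) = ν j *
      ∏ k ∈ Finset.univ.filter (fun k : Fin K => D ≤ (k : ℕ)),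
        (ω (Fin.castLE hDK j) - ω k)⁻¹)
    (f : Fin L → Polynomial F)
    (hf : ∀ l : Fin L, f l = Polynomial.X ^ (l : ℕ) *
      ∏ j ∈ Finset.univ.filter (fun j : Fin K => D ≤ (j : ℕ)),
        (Polynomial.X - Polynomial.C (ω j)))
    (c : Fin L → Fin (K - D + L) → F)
    (hc : ∀ (l : Fin L) (i : Fin (K - D + L)), c l i = (f l).coeff (i : ℕ))
    (G : Matrix (Fin (K - D + L)) (Fin K) F)
    (hG : ∀ (i : Fin (K - D + L)) (j : Fin K), G i j = alph j * ω j ^ (i : ℕ)) :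
    ∀ l : Fin L,
      (∀ j : Fin D,
        alph (Fin.castLE hDK j) * (f l).eval (ω (Fin.castLE hDK j))
          = ν j * ω (Fin.castLE hDK j) ^ (l : ℕ)) ∧
      (∀ j : Fin K, D ≤ (j : ℕ) → (f l).eval (ω j) = 0) ∧
      (∀ j : Fin K, (∑ i : Fin (K - D + L), c l i * G i j)
          = if h : (j : ℕ) < D then ν ⟨(j : ℕ), h⟩ * ω j ^ (l : ℕ) else 0) := by
  intro l
  set S := Finset.univ.filter (fun k : Fin K => D ≤ (k : ℕ)) with hS
  have eval_f (x : F) : (f l).eval x = x ^ (l : ℕ) * ∏ k ∈ S, (x - ω k) := by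
    simp [hf, Polynomial.eval_prod]
  have eval_head (j : Fin D) : alph (Fin.castLE hDK j) * (f l).eval (ω (Fin.castLE hDK j))
      = ν j * ω (Fin.castLE hDK j) ^ (l : ℕ) := by
    have hne : ∏ k ∈ S, (ω (Fin.castLE hDK j) - ω k) ≠ 0 := by
      refine Finset.prod_ne_zero_iff.mpr fun k hk h => ?_
      have hjk := congrArg Fin.val (hω (sub_eq_zero.mp h))
      have hDk : D ≤ (k : ℕ) := (Finset.mem_filter.mp hk).2
      have := j.isLt
      simp only [Fin.val_castLE] at hjk
      omega
    rw [halph, eval_f, Finset.prod_inv_distrib]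
    field_simp
  have eval_tail (j : Fin K) (hj : D ≤ (j : ℕ)) : (f l).eval (ω j) = 0 := by
    rw [eval_f, Finset.prod_eq_zero (i := j) (by simp [hS, hj]) (sub_self _), mul_zero]
  refine ⟨eval_head, eval_tail, fun j => ?_⟩
  have natDegree_lt : (f l).natDegree < K - D + L := by
    have hl := l.isLt
    rw [hf, natDegree_X_pow_mul_prod_X_sub_C, hS, card_filter_le_val]
    omega
  have sum_eq : (∑ i : Fin (K - D + L), c l i * G i j) = alph j * (f l).eval (ω j) := by
    rw [Polynomial.eval_eq_sum_range' natDegree_lt, Finset.mul_sum, Finset.sum_range]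
    refine Finset.sum_congr rfl fun i _ => ?_
    rw [hc, hG]
    ring
  rw [sum_eq]
  split_ifs with h
  · exact eval_head ⟨j, h⟩
  · rw [eval_tail j (not_lt.mp h), mul_zero]
end

section
/- Let F be a field and let 1 ≤ L ≤ D ≤ K. Let G be a (K-D+L) × K matrix over F whose row space C is a (K-D+L)-dimensional code in which every nonzero codeword has Hamming weight at least D - L + 1 (i.e., C is a [K, K-D+L] MDS code). Then for every D-subset W ⊆ {1, ..., K}, the set of codewords of C whose support is contained in W forms an L-dimensional subspace, and for any basis u_1, ..., u_L of this subspace, the L × D matrix formed by the restrictions of u_1, ..., u_L to the coordinates in W has every L × L submatrix invertible. -/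
/-- The subspace of `F^K` of vectors supported on a set `W` of coordinates (all
coordinates outside `W` vanish). -/
def supportedOn (F : Type*) [Field F] {K : ℕ} (W : Finset (Fin K)) :
    Submodule F (Fin K → F) where
  carrier := {x | ∀ j ∉ W, x j = 0}
  zero_mem' := by intro j hj; rfl
  add_mem' := by intro a b ha hb j hj; simp [ha j hj, hb j hj]
  smul_mem' := by intro c a ha j hj; simp [ha j hj]

/-- A vector supported on `W` and vanishing at `L` distinct coordinates of `W` has Hamming
weight at most `|W| - L`. -/
theorem hammingNorm_le_of_mem_supportedOn {F : Type*} [Field F] [DecidableEq F] {K L : ℕ}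
    {W : Finset (Fin K)} {c : Fin K → F} (hc : c ∈ supportedOn F W) (t : Fin L → Fin K)
    (ht : Function.Injective t) (htW : ∀ i, t i ∈ W) (hct : ∀ i, c (t i) = 0) :
    hammingNorm c ≤ W.card - L := by
  classical
  have hsub : Finset.univ.image t ⊆ W := by
    intro j hj
    obtain ⟨i, -, rfl⟩ := Finset.mem_image.mp hj
    exact htW i
  have hcard : (Finset.univ.image t).card = L := by
    rw [Finset.card_image_of_injective _ ht, Finset.card_univ, Fintype.card_fin]
  rw [← hcard, ← Finset.card_sdiff_of_subset hsub]
  refine Finset.card_le_card fun j hj => ?_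
  have hj0 : c j ≠ 0 := (Finset.mem_filter.mp hj).2
  refine Finset.mem_sdiff.mpr ⟨by_contra fun h => hj0 (hc j h), fun h => ?_⟩
  obtain ⟨i, -, rfl⟩ := Finset.mem_image.mp h
  exact hj0 (hct i)

/-- Imposing zeros outside `W` drops the dimension by at most the number of coordinates
outside `W`. -/
theorem finrank_le_finrank_inf_supportedOn_add {F : Type*} [Field F] {K : ℕ}
    (C : Submodule F (Fin K → F)) (W : Finset (Fin K)) :
    Module.finrank F C ≤ Module.finrank F ↥(C ⊓ supportedOn F W) + (K - W.card) := by
  let f : (Fin K → F) →ₗ[F] ({j // j ∉ W} → F) := LinearMap.funLeft F F Subtype.val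
  have hker : LinearMap.ker (f ∘ₗ C.subtype) = (supportedOn F W).comap C.subtype := by
    ext x
    simp only [LinearMap.mem_ker, Submodule.mem_comap]
    exact ⟨fun h j hj => congrFun h ⟨j, hj⟩, fun h => funext fun j => h j j.2⟩
  have hrange : Module.finrank F (LinearMap.range (f ∘ₗ C.subtype)) ≤ K - W.card := by
    refine (Submodule.finrank_le _).trans_eq ?_
    rw [Module.finrank_fintype_fun_eq_card, Fintype.card_subtype_compl]
    simp
  have hrn := LinearMap.finrank_range_add_finrank_ker (f ∘ₗ C.subtype)
  rw [hker, ← Submodule.finrank_map_subtype_eq, Submodule.map_comap_subtype] at hrn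
  omega

/-- let `1 ≤ L ≤ D ≤ K` and let `G` be a `(K-D+L) × K` matrix whose row
space `C` is a `[K, K-D+L]` MDS code (dimension `K-D+L`, every nonzero codeword of
Hamming weight at least `D-L+1`). Then for every `D`-subset `W` of coordinates, the
codewords of `C` with support contained in `W` form an `L`-dimensional subspace, and
for any basis `u_1, ..., u_L` of this subspace, the `L × D` matrix of the restrictions
of `u_1, ..., u_L` to the coordinates in `W` (listed in increasing order) has every
`L × L` submatrix invertible. -/
theorem stmt_14 {F : Type*} [Field F] [DecidableEq F] (K D L : ℕ)
    (hL : 1 ≤ L) (hLD : L ≤ D) (hDK : D ≤ K)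
    (G : Matrix (Fin (K - D + L)) (Fin K) F)
    (hdim : Module.finrank F ↥(Submodule.span F (Set.range fun i => G i)) = K - D + L)
    (hMDS : ∀ c ∈ Submodule.span F (Set.range fun i => G i),
      c ≠ 0 → D - L + 1 ≤ hammingNorm c)
    (W : Finset (Fin K)) (hW : W.card = D) :
    Module.finrank F
        ↥(Submodule.span F (Set.range fun i => G i) ⊓ supportedOn F W) = L ∧
      ∀ u : Fin L → (Fin K → F),
        (∀ l, u l ∈ Submodule.span F (Set.range fun i => G i) ⊓ supportedOn F W) →
        LinearIndependent F u →
        Submodule.span F (Set.range u)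
          = Submodule.span F (Set.range fun i => G i) ⊓ supportedOn F W →
        ∀ g : Fin L → Fin D, Function.Injective g →
          IsUnit ((Matrix.of fun (l : Fin L) (j : Fin D) =>
            u l ((W.orderIsoOfFin hW j : Fin K))).submatrix id g) := by
  set C := Submodule.span F (Set.range fun i => G i)
  have hzero : ∀ g : Fin L → Fin D, Function.Injective g → ∀ c ∈ C ⊓ supportedOn F W,
      (∀ i, c (W.orderIsoOfFin hW (g i) : Fin K) = 0) → c = 0 := by
    intro g hg c hc hcg
    by_contra hne
    have hlow := hMDS c hc.1 hne
    have hupp := hammingNorm_le_of_mem_supportedOn hc.2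
      (fun i => (W.orderIsoOfFin hW (g i) : Fin K))
      (Subtype.val_injective.comp ((W.orderIsoOfFin hW).injective.comp hg))
      (fun i => (W.orderIsoOfFin hW (g i)).2) hcg
    omega
  refine ⟨le_antisymm ?_ ?_, ?_⟩
  · let f : ↥(C ⊓ supportedOn F W) →ₗ[F] (Fin L → F) :=
      LinearMap.funLeft F F (fun i => (W.orderIsoOfFin hW (Fin.castLE hLD i) : Fin K)) ∘ₗ
        (C ⊓ supportedOn F W).subtype
    have hf : Function.Injective f := by
      refine (injective_iff_map_eq_zero f).mpr fun x hx => Subtype.ext ?_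
      exact hzero (Fin.castLE hLD) (Fin.castLE_injective hLD) x x.2 fun i => congrFun hx i
    simpa using LinearMap.finrank_le_finrank_of_injective hf
  · have h := finrank_le_finrank_inf_supportedOn_add C W
    omega
  · intro u hu hli _ g hg
    rw [← Matrix.linearIndependent_rows_iff_isUnit, Fintype.linearIndependent_iff]
    intro a ha
    refine Fintype.linearIndependent_iff.mp hli a ?_
    refine hzero g hg _ (Submodule.sum_mem _ fun l _ => Submodule.smul_mem _ _ (hu l)) fun i => ?_
    simpa [Finset.sum_apply] using congrFun ha i
end
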